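/- arXiv:2510.00996 — 2 statements merged into one kernel-verified Lean document; each statement's English description precedes it below -/
import Mathlib

section
/- Let E and F be real normed vector spaces, let n be a natural number, and let f : (Fin n → E) → F be L-Lipschitz with respect to the supremum norm on the product space (Fin n → E). Let v : Fin n → E be a family of vectors (the unconditional value cache) and let ŵ : Fin n → ℝ be step-normalized perturbation weights satisfying 0 ≤ ŵ i ≤ 1 for all i and ∑ i, (1 - ŵ i) = 1. Then the deviation of the perturbed output from the unperturbed output is bounded by one token's contribution: ‖f (fun i => ŵ i • v i) - f v‖ ≤ L * (Finset.univ.sup' (by positivity-style nonemptiness from the sum condition) (fun i => ‖v i‖)), i.e. ‖f (fun i => ŵ i • v i) - f v‖ ≤ L * max_{i < n} ‖v i‖. -/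
/-- **Bounded deviation of Step-Normalized SoftCFG.**
If `f : (Fin n → E) → F` is `L`-Lipschitz with respect to the supremum norm on
the product space, `v` is the unconditional value cache, and `ŵ` are
step-normalized perturbation weights with `0 ≤ ŵ i ≤ 1` and `∑ i, (1 - ŵ i) = 1`,
then the deviation of the perturbed output from the unperturbed one is bounded by
(at most) a single token's contribution: `L * max_{i < n} ‖v i‖`. -/
theorem softcfg_stepnorm_deviation_bound
    {E F : Type*} [NormedAddCommGroup E] [NormedSpace ℝ E]
    [NormedAddCommGroup F] [NormedSpace ℝ F]
    {n : ℕ} (f : (Fin n → E) → F) (L : ℝ)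
    (hf : ∀ x y : Fin n → E, ‖f x - f y‖ ≤ L * ‖x - y‖)
    (v : Fin n → E) (w : Fin n → ℝ)
    (hw : ∀ i, 0 ≤ w i ∧ w i ≤ 1)
    (hsum : ∑ i, (1 - w i) = 1) :
    ‖f (fun i => w i • v i) - f v‖ ≤ L * ⨆ i, ‖v i‖ := by
  have hdev : ‖(fun i => w i • v i) - v‖ ≤ ⨆ i, ‖v i‖ := by
    refine (pi_norm_le_iff_of_nonneg (Real.iSup_nonneg fun i => norm_nonneg (v i))).2 fun i => ?_
    have hi : ((fun i => w i • v i) - v) i = (w i - 1) • v i := by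
      simp [sub_smul]
    have habs : ‖w i - 1‖ ≤ 1 := by
      rw [Real.norm_eq_abs, abs_le]
      constructor <;> linarith [(hw i).1, (hw i).2]
    calc ‖((fun i => w i • v i) - v) i‖ = ‖w i - 1‖ * ‖v i‖ := by rw [hi, norm_smul]
      _ ≤ ‖v i‖ := mul_le_of_le_one_left (norm_nonneg _) habs
      _ ≤ ⨆ i, ‖v i‖ := le_ciSup (f := fun i => ‖v i‖) (Set.finite_range _).bddAbove i
  rcases le_or_gt 0 L with hL | hL
  · exact (hf _ _).trans (mul_le_mul_of_nonneg_left hdev hL)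
  · have hv : v = 0 := by
      have h := (norm_nonneg _).trans (hf v 0)
      rw [sub_zero] at h
      exact norm_le_zero_iff.1 (nonpos_of_mul_nonneg_right h hL)
    subst hv
    have hzero : (fun i => w i • (0 : Fin n → E) i) = 0 := funext fun i => smul_zero (w i)
    rw [hzero]
    simp
end

section
/- Let E and F be real normed vector spaces, let n be a natural number, let f : (Fin n → E) → F be L-Lipschitz with respect to the supremum norm on the product space, let v : Fin n → E, let γ ≥ 0, and let ŵ : Fin n → ℝ be step-normalized weights satisfying 0 ≤ ŵ i ≤ 1 for all i and ∑ i, (1 - ŵ i) = 1. For any z_cond : F, set z_CFG := (1 + γ) • z_cond - γ • f v and z_SoftCFG := (1 + γ) • z_cond - γ • f (fun i => ŵ i • v i). Then ‖z_SoftCFG - z_CFG‖ ≤ γ * L * max_{i < n} ‖v i‖. -/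
/-- **Step-Normalized SoftCFG stays close to vanilla CFG.**
With `f` the `L`-Lipschitz logit map (w.r.t. the supremum norm on the value
cache), `v` the unconditional value cache, step-normalized weights `ŵ i ∈ [0,1]`
with `∑ i, (1 - ŵ i) = 1`, and guidance scale `γ ≥ 0`, the guided logits
`z_CFG = (1+γ)•z_cond - γ•f v` and
`z_SoftCFG = (1+γ)•z_cond - γ•f (fun i => ŵ i • v i)` satisfy
`‖z_SoftCFG - z_CFG‖ ≤ γ * L * max_{i < n} ‖v i‖`. -/
theorem softcfg_stepnorm_vs_cfg_bound
    {E F : Type*} [NormedAddCommGroup E] [NormedSpace ℝ E]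
    [NormedAddCommGroup F] [NormedSpace ℝ F]
    {n : ℕ} (f : (Fin n → E) → F) (L : ℝ)
    (hf : ∀ x y : Fin n → E, ‖f x - f y‖ ≤ L * ‖x - y‖)
    (v : Fin n → E) (w : Fin n → ℝ)
    (hw : ∀ i, 0 ≤ w i ∧ w i ≤ 1)
    (hsum : ∑ i, (1 - w i) = 1)
    (γ : ℝ) (hγ : 0 ≤ γ) (z_cond : F) :
    ‖((1 + γ) • z_cond - γ • f (fun i => w i • v i)) -
        ((1 + γ) • z_cond - γ • f v)‖
      ≤ γ * L * ⨆ i, ‖v i‖ := by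
  have norm_le : ‖v‖ ≤ ⨆ i, ‖v i‖ :=
    (pi_norm_le_iff_of_nonneg (Real.iSup_nonneg fun i => norm_nonneg (v i))).2
      fun i => le_ciSup (f := fun i => ‖v i‖) (Set.finite_range _).bddAbove i
  have damp_le : ‖v - (fun i => w i • v i)‖ ≤ ‖v‖ := by
    refine (pi_norm_le_iff_of_nonneg (norm_nonneg v)).2 fun i => ?_
    obtain ⟨h0, h1⟩ := hw i
    have hi : (v - fun i => w i • v i) i = (1 - w i) • v i := by
      simp [sub_smul]
    rw [hi, norm_smul, Real.norm_of_nonneg (by linarith)]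
    exact (mul_le_of_le_one_left (norm_nonneg _) (by linarith)).trans (norm_le_pi_norm v i)
  have hdiff : ((1 + γ) • z_cond - γ • f (fun i => w i • v i)) - ((1 + γ) • z_cond - γ • f v)
      = γ • (f v - f (fun i => w i • v i)) := by
    rw [smul_sub]
    abel
  rw [hdiff, norm_smul, Real.norm_of_nonneg hγ, mul_assoc]
  refine mul_le_mul_of_nonneg_left ?_ hγ
  refine (hf _ _).trans ?_
  rcases le_or_gt 0 L with hL | hL
  · exact mul_le_mul_of_nonneg_left (damp_le.trans norm_le) hL
  · have hv : v = 0 := by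
      have h := (norm_nonneg _).trans (hf v 0)
      rw [sub_zero] at h
      exact norm_le_zero_iff.1 (nonpos_of_mul_nonneg_right h hL)
    have hd : v - (fun i => w i • v i) = 0 := by
      ext i
      simp [hv]
    rw [hd, norm_zero, mul_zero]
    simp [hv]
end
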